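/- arXiv:1605.01795 — 4 statements merged into one kernel-verified Lean document; each statement's English description precedes it below -/
import Mathlib

section
/- Let G be the free group of rank 2, let A4 be the alternating group on 4 letters, let K be the Klein four subgroup of A4, and let Z2 be a subgroup of K of order 2 (generated by one double transposition). Let φ : G → A4 be any surjective homomorphism, and set H1 = φ^{-1}(Z2) and H2 = φ^{-1}(K). Then H2 is elementwise conjugate into H1 (i.e., for every h ∈ H2 there exists g ∈ G with g^{-1} h g ∈ H1), but H2 is not conjugate into H1 (i.e., there is no g ∈ G with g^{-1} H2 g ⊆ H1). -/
/-- The subgroup generated by two commuting involutions consists of `1`, `a`, `b` and `a * b`. -/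
theorem mem_closure_pair_of_commuting_involutions {G : Type*} [Group G] {a b x : G}
    (haa : a * a = 1) (hbb : b * b = 1) (hab : Commute a b)
    (hx : x ∈ Subgroup.closure {a, b}) : x = 1 ∨ x = a ∨ x = b ∨ x = a * b := by
  have ha_mul (y : G) : a * (a * y) = y := by rw [← mul_assoc, haa, one_mul]
  have hba_mul (y : G) : b * (a * y) = a * (b * y) := by
    rw [← mul_assoc, ← hab.eq, mul_assoc]
  have ha_inv : a⁻¹ = a := inv_eq_of_mul_eq_one_left haa
  have hb_inv : b⁻¹ = b := inv_eq_of_mul_eq_one_left hbb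
  induction hx using Subgroup.closure_induction with
  | mem x hx => rcases hx with rfl | rfl <;> simp
  | one => simp
  | mul x y _ _ hx hy =>
    rcases hx with rfl | rfl | rfl | rfl <;> rcases hy with rfl | rfl | rfl | rfl <;>
      simp [mul_assoc, haa, hbb, ← hab.eq, ha_mul, hba_mul]
  | inv x _ hx =>
    rcases hx with rfl | rfl | rfl | rfl <;> simp [ha_inv, hb_inv, ← hab.eq]

/-- The subgroup generated by an involution consists of `1` and `a`. -/
theorem mem_closure_singleton_of_involution {G : Type*} [Group G] {a x : G}
    (haa : a * a = 1) (hx : x ∈ Subgroup.closure {a}) : x = 1 ∨ x = a := by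
  have := mem_closure_pair_of_commuting_involutions haa haa (Commute.refl a) (by simpa using hx)
  simp only [haa] at this
  tauto

/-- G the free group of rank 2, A4 = alternating group on 4 letters, K its Klein
four subgroup, Z2 ≤ K of order 2 generated by the double transposition (0 1)(2 3).
For any surjective φ : G → A4, H2 = φ⁻¹(K) is elementwise conjugate into
H1 = φ⁻¹(Z2), but H2 is not conjugate into H1. -/
theorem stmt_0 (φ : FreeGroup (Fin 2) →* alternatingGroup (Fin 4))
    (hφ : Function.Surjective φ)
    (a b : alternatingGroup (Fin 4))
    (ha : (a : Equiv.Perm (Fin 4)) = Equiv.swap 0 1 * Equiv.swap 2 3)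
    (hb : (b : Equiv.Perm (Fin 4)) = Equiv.swap 0 2 * Equiv.swap 1 3)
    (K Z2 : Subgroup (alternatingGroup (Fin 4)))
    (hK : K = Subgroup.closure {a, b})
    (hZ2 : Z2 = Subgroup.closure {a})
    (H1 H2 : Subgroup (FreeGroup (Fin 2)))
    (hH1 : H1 = Z2.comap φ) (hH2 : H2 = K.comap φ) :
    (∀ h ∈ H2, ∃ g : FreeGroup (Fin 2), g⁻¹ * h * g ∈ H1) ∧
      ¬ ∃ g : FreeGroup (Fin 2), ∀ h ∈ H2, g⁻¹ * h * g ∈ H1 := by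
  subst hK hZ2 hH1 hH2
  have haa : a * a = 1 := Subtype.ext (by push_cast; rw [ha]; decide)
  have hbb : b * b = 1 := Subtype.ext (by push_cast; rw [hb]; decide)
  have hab : Commute a b := Subtype.ext (by push_cast; rw [ha, hb]; decide)
  have ha_one : a ≠ 1 := fun h => by
    rw [h] at ha
    exact absurd ha (by decide)
  have hb_one : b ≠ 1 := fun h => by
    rw [h] at hb
    exact absurd hb (by decide)
  have hne : a ≠ b := fun h => by
    rw [h, hb] at ha
    exact absurd ha (by decide)
  obtain ⟨c, hc⟩ : ∃ c : alternatingGroup (Fin 4),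
      (c : Equiv.Perm (Fin 4)) = Equiv.swap 0 1 * Equiv.swap 1 2 :=
    ⟨⟨_, by rw [Equiv.Perm.mem_alternatingGroup]; decide⟩, rfl⟩
  have hcb : c * b * c⁻¹ = a := Subtype.ext (by push_cast; rw [ha, hb, hc]; decide)
  have hcab : c⁻¹ * (a * b) * c = a := Subtype.ext (by push_cast; rw [ha, hb, hc]; decide)
  obtain ⟨g, rfl⟩ := hφ c
  have ha_mem : a ∈ Subgroup.closure {a} := Subgroup.subset_closure rfl
  simp only [Subgroup.mem_comap, map_mul, map_inv]
  constructor
  · intro h hh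
    rcases mem_closure_pair_of_commuting_involutions haa hbb hab hh with h1 | h1 | h1 | h1
    · exact ⟨1, by simp [h1]⟩
    · exact ⟨1, by simp [h1]⟩
    · exact ⟨g⁻¹, by rwa [h1, map_inv, inv_inv, hcb]⟩
    · exact ⟨g, by rwa [h1, hcab]⟩
  · rintro ⟨k, hk⟩
    have conj_eq {x : alternatingGroup (Fin 4)} (hx : x ∈ Subgroup.closure {a, b})
        (hx_one : x ≠ 1) : (φ k)⁻¹ * x * φ k = a := by
      obtain ⟨h, rfl⟩ := hφ x
      refine (mem_closure_singleton_of_involution haa (hk h hx)).resolve_left fun h1 => hx_one ?_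
      exact (conj_eq_one_iff (a := (φ k)⁻¹)).mp (by rwa [inv_inv])
    have hab_conj := (conj_eq (Subgroup.subset_closure (by simp)) ha_one).trans
      (conj_eq (Subgroup.subset_closure (by simp)) hb_one).symm
    exact hne (mul_left_cancel (mul_right_cancel hab_conj))
end

section
/- Let G be a group with the unique root property and let H be a retract of G, i.e., there exists a homomorphism f : G → G with image H such that f(h) = h for all h ∈ H. If g ∈ G satisfies g^n ∈ H for some integer n ≥ 1, then g ∈ H. In other words, retracts of groups with the unique root property are closed under taking roots. -/
/-- Retracts of groups with the unique root property are closed under taking roots. -/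
theorem stmt_1 (G : Type*) [Group G]
    (uniqueRoot : ∀ (x y : G) (n : ℤ), n ≠ 0 → x ^ n = y ^ n → x = y)
    (H : Subgroup G) (f : G →* G) (hrange : f.range = H)
    (hfix : ∀ h ∈ H, f h = h)
    (g : G) (n : ℤ) (hn : 1 ≤ n) (hg : g ^ n ∈ H) : g ∈ H := by
  have hfg : f g = g :=
    uniqueRoot (f g) g n (by lia) (by rw [← map_zpow, hfix _ hg])
  rw [← hrange]
  exact ⟨g, hfg⟩
end

section
/- Let G = A ∗ B be the free product of two groups A and B, and let ι_B : B → G denote the canonical embedding. If H is a finitely generated subgroup of G such that every element of H is conjugate in G to an element of ι_B(B), then there exists g ∈ G with g^{-1} H g ⊆ ι_B(B). -/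
open Monoid

namespace Monoid.CoprodI

variable {ι : Type*} {M : ι → Type*} [∀ i, Group (M i)]

section Length

variable [∀ i, DecidableEq (M i)]

theorem Word.length_rcons_le {i : ι} (p : Word.Pair M i) :
    (Word.rcons p).toList.length ≤ p.tail.toList.length + 1 := by
  unfold Word.rcons
  split_ifs <;> simp [Word.cons]

theorem Word.length_tail_le_rcons {i : ι} (p : Word.Pair M i) :
    p.tail.toList.length ≤ (Word.rcons p).toList.length := by
  unfold Word.rcons
  split_ifs <;> simp [Word.cons]

variable [DecidableEq ι]

/-- The length of the normal form of an element of a free product. -/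
def normLength (x : CoprodI M) : ℕ := (Word.equiv x).toList.length

theorem normLength_neWord_prod {i j : ι} (w : NeWord M i j) :
    normLength w.prod = w.toList.length :=
  congrArg (fun v : Word M => v.toList.length) (Word.equiv.apply_symm_apply w.toWord)

theorem normLength_of_mul_le {i : ι} (m : M i) (y : CoprodI M) :
    normLength (of m * y) ≤ normLength y + 1 := by
  have h : Word.equiv (of m * y) = of m • Word.equiv y :=
    mul_smul (of m) y (Word.empty : Word M)
  have hy := Word.length_tail_le_rcons (Word.equivPair i (Word.equiv y))
  rw [← Word.equivPair_symm, Equiv.symm_apply_apply] at hy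
  unfold normLength
  rw [h, Word.of_smul_def]
  exact (Word.length_rcons_le _).trans (Nat.succ_le_succ hy)

theorem exists_normLength_mul_le (g : CoprodI M) :
    ∃ C, ∀ y, normLength (g * y) ≤ normLength y + C := by
  induction g using CoprodI.induction_on with
  | one => exact ⟨0, fun y => by simp⟩
  | of i m => exact ⟨1, normLength_of_mul_le m⟩
  | mul a b ha hb =>
    obtain ⟨C, hC⟩ := ha
    obtain ⟨D, hD⟩ := hb
    refine ⟨C + D, fun y => ?_⟩
    have h₁ := hC (b * y)
    have h₂ := hD y
    rw [mul_assoc]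
    omega

end Length

theorem NeWord.exists_prod_eq_pow {i j : ι} (hij : i ≠ j) (w : NeWord M i j) (n : ℕ) :
    ∃ v : NeWord M i j, v.prod = w.prod ^ (n + 1) ∧ n + 1 ≤ v.toList.length := by
  have hw : 1 ≤ w.toList.length := List.length_pos_iff.mpr w.toList_ne_nil
  induction n with
  | zero => exact ⟨w, by simp, by simpa using hw⟩
  | succ n ih =>
    obtain ⟨v, hv, hlen⟩ := ih
    refine ⟨v.append hij.symm w, by rw [NeWord.append_prod, hv, pow_succ _ (n + 1)], ?_⟩
    simp only [NeWord.toList, List.length_append]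
    omega

/-- A reduced word whose first and last letters come from different factors is not conjugate
into a factor. -/
theorem NeWord.prod_ne_conj_of {i j k : ι} (hij : i ≠ j) (w : NeWord M i j)
    (g : CoprodI M) (x : M k) : w.prod ≠ g * of x * g⁻¹ := by
  classical
  intro h
  obtain ⟨C, hC⟩ := exists_normLength_mul_le g
  obtain ⟨v, hv, hlen⟩ := w.exists_prod_eq_pow hij (normLength g⁻¹ + C + 1)
  have hpow : v.prod = g * (of (x ^ (normLength g⁻¹ + C + 1 + 1)) * g⁻¹) := by
    rw [hv, h, conj_pow, map_pow, mul_assoc]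
  have h₁ := hC (of (x ^ (normLength g⁻¹ + C + 1 + 1)) * g⁻¹)
  have h₂ := normLength_of_mul_le (x ^ (normLength g⁻¹ + C + 1 + 1)) g⁻¹
  rw [← hpow, normLength_neWord_prod] at h₁
  omega

/-- Splitting off the last letter of a reduced word if it comes from the factor `M i`. -/
theorem NeWord.exists_prod_eq_mul_of (i : ι) {j l : ι} (w : NeWord M j l) :
    (j = i ∧ ∃ b : M i, w.prod = of b) ∨
      ∃ l', l' ≠ i ∧ ∃ (v : NeWord M j l') (b : M i), w.prod = v.prod * of b := by
  induction w with
  | @singleton j x hx =>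
    by_cases h : j = i
    · subst h
      exact .inl ⟨rfl, x, by simp⟩
    · exact .inr ⟨j, h, .singleton x hx, 1, by simp⟩
  | @append _ k _ _ w₁ hne w₂ _ ih =>
    right
    rcases ih with ⟨rfl, b, hb⟩ | ⟨l', hl', v, b, hb⟩
    · exact ⟨k, hne, w₁, b, by rw [NeWord.append_prod, hb]⟩
    · exact ⟨l', hl', w₁.append hne v, b, by
        rw [NeWord.append_prod, NeWord.append_prod, hb, mul_assoc]⟩

/-- Representatives of the double cosets of a factor of a free product. -/
theorem exists_eq_of_mul_neWord_mul_of (i : ι) (g : CoprodI M) :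
    (∃ b : M i, g = of b) ∨ ∃ j l, j ≠ i ∧ l ≠ i ∧
      ∃ (a : M i) (w : NeWord M j l) (b : M i), g = of a * w.prod * of b := by
  classical
  set p := Word.equivPair i (Word.equiv g)
  have hg : g = of p.head * p.tail.prod := by
    rw [← Word.prod_rcons, ← Word.equivPair_symm, Equiv.symm_apply_apply]
    exact (Word.equiv.symm_apply_apply g).symm
  by_cases hp : p.tail = Word.empty
  · exact .inl ⟨p.head, by rw [hg, hp, Word.prod_empty, mul_one]⟩
  obtain ⟨j, l, w, hw⟩ := NeWord.of_word p.tail hp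
  have hj : j ≠ i := by
    rintro rfl
    apply p.fstIdx_ne
    rw [← hw, Word.fstIdx]
    simp [NeWord.toWord, NeWord.toList_head?]
  rcases w.exists_prod_eq_mul_of i with ⟨hji, -⟩ | ⟨l', hl', v, b, hb⟩
  · exact absurd hji hj
  · exact .inr ⟨j, l', hj, hl', p.head, v, b, by
      rw [hg, ← hw, mul_assoc, ← hb, NeWord.prod]⟩

theorem exists_eq_of_of_mul_conj_eq_conj {i : ι} {x y z : M i} (hx : x ≠ 1) (hy : y ≠ 1)
    {g c : CoprodI M} (h : of x * (g * of y * g⁻¹) = c * of z * c⁻¹) :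
    ∃ b : M i, g = of b := by
  refine (exists_eq_of_mul_neWord_mul_of i g).resolve_right ?_
  rintro ⟨j, l, hj, hl, a, w, b, rfl⟩
  have hx' : a⁻¹ * x * a ≠ 1 := by simpa using (conj_eq_one_iff (a := a⁻¹)).not.mpr hx
  have hy' : b * y * b⁻¹ ≠ 1 := conj_eq_one_iff.not.mpr hy
  let u := (NeWord.singleton _ hx').append hj.symm
    (w.append hl ((NeWord.singleton _ hy').append hl.symm w.inv))
  refine u.prod_ne_conj_of hj.symm ((of a)⁻¹ * c) z ?_
  calc u.prod = (of a)⁻¹ * (of x *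
        (of a * w.prod * of b * of y * (of a * w.prod * of b)⁻¹)) * of a := by
        simp only [u, NeWord.append_prod, NeWord.prod_singleton, NeWord.inv_prod, map_mul, map_inv]
        group
    _ = _ := by rw [h]; group

/-- A subgroup of a free product that is elementwise conjugate into a factor is conjugate into
that factor. -/
theorem exists_conj_of_forall_exists_conj (i : ι) (H : Subgroup (CoprodI M))
    (hH : ∀ h ∈ H, ∃ (g : CoprodI M) (x : M i), h = g * of x * g⁻¹) :
    ∃ g : CoprodI M, ∀ h ∈ H, ∃ x : M i, h = g * of x * g⁻¹ := by
  by_cases hbot : ∀ h ∈ H, h = 1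
  · exact ⟨1, fun h hh => ⟨1, by simp [hbot h hh]⟩⟩
  push Not at hbot
  obtain ⟨h, hh, hne⟩ := hbot
  obtain ⟨g, x, rfl⟩ := hH h hh
  refine ⟨g, fun k hk => ?_⟩
  by_cases hk1 : k = 1
  · exact ⟨1, by simp [hk1]⟩
  obtain ⟨g', y, rfl⟩ := hH k hk
  obtain ⟨c, z, hc⟩ := hH _ (H.mul_mem hh hk)
  have hx : x ≠ 1 := by rintro rfl; simp at hne
  have hy : y ≠ 1 := by rintro rfl; simp at hk1
  obtain ⟨b, hb⟩ := exists_eq_of_of_mul_conj_eq_conj hx hy (g := g⁻¹ * g') (c := g⁻¹ * c) (z := z)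
    (calc _ = g⁻¹ * (g * of x * g⁻¹ * (g' * of y * g'⁻¹)) * g := by group
      _ = _ := by rw [hc]; group)
  refine ⟨b * y * b⁻¹, ?_⟩
  rw [map_mul, map_mul, map_inv, ← hb]
  group

end Monoid.CoprodI

namespace Monoid.Coprod

universe u v

/-- The two factors of a binary free product as a family over `Bool`, in a common universe. -/
def BoolFamily (A : Type u) (B : Type v) : Bool → Type (max u v)
  | false => ULift.{v} A
  | true => ULift.{u} B

variable (A : Type u) (B : Type v) [Group A] [Group B]

instance : ∀ i, Group (BoolFamily A B i)
  | false => inferInstanceAs (Group (ULift.{v} A))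
  | true => inferInstanceAs (Group (ULift.{u} B))

/-- The left factor as a member of the family. -/
def boolFamilyFalse : BoolFamily A B false ≃* A := MulEquiv.ulift

/-- The right factor as a member of the family. -/
def boolFamilyTrue : BoolFamily A B true ≃* B := MulEquiv.ulift

/-- The map from the indexed free product of two groups to their binary free product. -/
def ofCoprodI : CoprodI (BoolFamily A B) →* Coprod A B :=
  CoprodI.lift fun
    | false => inl.comp (boolFamilyFalse A B).toMonoidHom
    | true => inr.comp (boolFamilyTrue A B).toMonoidHom

/-- The map from the binary free product of two groups to their indexed free product. -/
def toCoprodI : Coprod A B →* CoprodI (BoolFamily A B) :=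
  lift (CoprodI.of.comp (boolFamilyFalse A B).symm.toMonoidHom)
    (CoprodI.of.comp (boolFamilyTrue A B).symm.toMonoidHom)

/-- The binary free product as an indexed free product. -/
def equivCoprodI : Coprod A B ≃* CoprodI (BoolFamily A B) :=
  MonoidHom.toMulEquiv (toCoprodI A B) (ofCoprodI A B)
    (by ext x <;> simp [toCoprodI, ofCoprodI])
    (by
      refine CoprodI.ext_hom _ _ fun i => ?_
      cases i <;> ext x <;> simp [toCoprodI, ofCoprodI])

theorem equivCoprodI_inr (b : B) :
    equivCoprodI A B (inr b) = CoprodI.of ((boolFamilyTrue A B).symm b) := by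
  simp [equivCoprodI, toCoprodI]

end Monoid.Coprod

/-- In a free product A ∗ B, a finitely generated subgroup that is elementwise
conjugate into the factor B is conjugate into B. -/
theorem stmt_7 {A B : Type*} [Group A] [Group B]
    (H : Subgroup (Monoid.Coprod A B)) (hfg : H.FG)
    (hconj : ∀ h ∈ H, ∃ g : Monoid.Coprod A B,
      g⁻¹ * h * g ∈ (Monoid.Coprod.inr : B →* Monoid.Coprod A B).range) :
    ∃ g : Monoid.Coprod A B, ∀ h ∈ H,
      g⁻¹ * h * g ∈ (Monoid.Coprod.inr : B →* Monoid.Coprod A B).range := by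
  let e := Coprod.equivCoprodI A B
  obtain ⟨g, hg⟩ := CoprodI.exists_conj_of_forall_exists_conj true (H.map e.toMonoidHom) (by
    rintro _ ⟨h, hh, rfl⟩
    obtain ⟨g, b, hb⟩ := hconj h hh
    have hh' : h = g * Coprod.inr b * g⁻¹ := by rw [hb]; group
    refine ⟨e g, (Coprod.boolFamilyTrue A B).symm b, ?_⟩
    rw [← Coprod.equivCoprodI_inr, ← map_inv, ← map_mul, ← map_mul, ← hh']
    rfl)
  refine ⟨e.symm g, fun h hh => ?_⟩
  obtain ⟨x, hx⟩ := hg _ (Subgroup.mem_map_of_mem _ hh)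
  refine ⟨Coprod.boolFamilyTrue A B x, e.injective ?_⟩
  have hx' : e h = g * CoprodI.of x * g⁻¹ := hx
  rw [Coprod.equivCoprodI_inr, MulEquiv.symm_apply_apply, map_mul, map_mul, map_inv,
    MulEquiv.apply_symm_apply, hx']
  group
end

section
/- Let G = A ∗_C B be an amalgamated free product of two groups A and B over a common subgroup C (given by embeddings of C into A and into B), and let ι_A : A → G and ι_B : B → G denote the canonical homomorphisms. If H is a finitely generated subgroup of G such that every element of H is conjugate in G to an element of ι_B(B), then there exists g ∈ G such that g^{-1} H g ⊆ ι_A(A) or g^{-1} H g ⊆ ι_B(B). -/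
namespace Monoid.PushoutI

section Amalgam

variable {ι : Type*} {G : ι → Type*} {C : Type*} [∀ i, Group (G i)] [Group C]
  (φ : ∀ i, C →* G i)

/-- The product in the pushout of a list of letters. -/
def listProd (l : List (Σ i, G i)) : PushoutI φ :=
  (l.map fun x => of (φ := φ) x.1 x.2).prod

/-- A list of letters is reduced if adjacent letters come from different factors and no letter
lies in the image of the base group. -/
def IsReducedList (l : List (Σ i, G i)) : Prop :=
  l.IsChain (fun x y => x.1 ≠ y.1) ∧ ∀ x ∈ l, x.2 ∉ (φ x.1).range

/-- The list of letters whose product is the inverse of the product of `l`. -/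
def invList (l : List (Σ i, G i)) : List (Σ i, G i) :=
  (l.map fun x => (⟨x.1, x.2⁻¹⟩ : Σ i, G i)).reverse

/-- `x` is the product of an element of the base group and a reduced list of at most `n`
letters. -/
def LengthLE (n : ℕ) (x : PushoutI φ) : Prop :=
  ∃ (c : C) (l : List (Σ i, G i)),
    IsReducedList φ l ∧ l.length ≤ n ∧ x = base φ c * listProd φ l

variable {φ}

@[simp]
theorem listProd_nil : listProd φ [] = 1 := by simp [listProd]

@[simp]
theorem listProd_cons (x : Σ i, G i) (l : List (Σ i, G i)) :
    listProd φ (x :: l) = of x.1 x.2 * listProd φ l := by simp [listProd]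

@[simp]
theorem listProd_append (l m : List (Σ i, G i)) :
    listProd φ (l ++ m) = listProd φ l * listProd φ m := by simp [listProd]

@[simp]
theorem listProd_invList (l : List (Σ i, G i)) :
    listProd φ (invList l) = (listProd φ l)⁻¹ := by
  induction l with
  | nil => simp [invList]
  | cons x l ih =>
    have : invList (x :: l) = invList l ++ [⟨x.1, x.2⁻¹⟩] := by simp [invList]
    rw [this, listProd_append, ih]
    simp

theorem IsReducedList.nil : IsReducedList φ [] := by simp [IsReducedList]

theorem isReducedList_cons {x : Σ i, G i} {l : List (Σ i, G i)} :
    IsReducedList φ (x :: l) ↔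
      x.2 ∉ (φ x.1).range ∧ (∀ y ∈ l.head?, x.1 ≠ y.1) ∧ IsReducedList φ l := by
  simp only [IsReducedList, List.isChain_cons, List.forall_mem_cons]
  tauto

theorem isReducedList_append {l m : List (Σ i, G i)} :
    IsReducedList φ (l ++ m) ↔ IsReducedList φ l ∧ IsReducedList φ m ∧
      ∀ x ∈ l.getLast?, ∀ y ∈ m.head?, x.1 ≠ y.1 := by
  simp only [IsReducedList, List.isChain_append, List.forall_mem_append]
  tauto

theorem IsReducedList.invList {l : List (Σ i, G i)} (hl : IsReducedList φ l) :
    IsReducedList φ (invList l) := by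
  refine ⟨?_, ?_⟩
  · rw [PushoutI.invList, List.isChain_reverse, List.isChain_map]
    exact hl.1.imp fun _ _ h => h.symm
  · intro x hx
    simp only [PushoutI.invList, List.mem_reverse, List.mem_map] at hx
    obtain ⟨y, hy, rfl⟩ := hx
    simpa using hl.2 y hy

theorem IsReducedList.length_eq (hφ : ∀ i, Function.Injective (φ i))
    {l m : List (Σ i, G i)} (hl : IsReducedList φ l) (hm : IsReducedList φ m) {c : C}
    (h : listProd φ l = base φ c * listProd φ m) : l.length = m.length := by
  classical
  obtain ⟨d⟩ := NormalWord.transversal_nonempty φ hφ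
  have key : ∀ l : List (Σ i, G i), IsReducedList φ l → ∃ w : NormalWord d,
      w.prod = listProd φ l ∧ w.toList.length = l.length := by
    intro l hl
    let w : CoprodI.Word G := ⟨l, fun x hx h1 => hl.2 x hx (h1 ▸ one_mem _), hl.1⟩
    obtain ⟨w', hw', hw''⟩ := Reduced.exists_normalWord_prod_eq (φ := φ) (w := w) d hl.2
    refine ⟨w', ?_, by simpa [w] using congrArg List.length hw''⟩
    rw [hw']
    simp [w, CoprodI.Word.prod, listProd, map_list_prod, Function.comp_def]
  obtain ⟨w, hw, hwl⟩ := key l hl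
  obtain ⟨v, hv, hvm⟩ := key m hm
  rw [← hw, ← hv, ← NormalWord.prod_base_smul] at h
  rw [← hwl, ← hvm, NormalWord.prod_injective h]
  rfl

theorem LengthLE.base_mul {n : ℕ} {x : PushoutI φ} (hx : LengthLE φ n x) (c : C) :
    LengthLE φ n (base φ c * x) := by
  obtain ⟨c', l, hl, hn, rfl⟩ := hx
  exact ⟨c * c', l, hl, hn, by rw [map_mul, mul_assoc]⟩

theorem LengthLE.of_mul {n : ℕ} {x : PushoutI φ} (hx : LengthLE φ n x) (i : ι) (g : G i) :
    LengthLE φ (n + 1) (of i g * x) := by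
  obtain ⟨c, l, hl, hn, rfl⟩ := hx
  rw [← of_apply_eq_base φ i c, ← mul_assoc, ← map_mul]
  generalize g * φ i c = g
  by_cases hg : g ∈ (φ i).range
  · obtain ⟨c', rfl⟩ := hg
    exact ⟨c', l, hl, by lia, by rw [of_apply_eq_base]⟩
  · by_cases hi : ∀ y ∈ l.head?, i ≠ y.1
    · exact ⟨1, ⟨i, g⟩ :: l, isReducedList_cons.2 ⟨hg, hi, hl⟩, by simpa using hn, by simp⟩
    · cases l with
      | nil => simp at hi
      | cons y t =>
        obtain ⟨j, a⟩ := y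
        obtain rfl : i = j := by simpa using hi
        rw [isReducedList_cons] at hl
        simp only [List.length_cons] at hn
        rw [listProd_cons, ← mul_assoc, ← map_mul]
        by_cases ha : g * a ∈ (φ i).range
        · obtain ⟨c', hc'⟩ := ha
          exact ⟨c', t, hl.2.2, by lia, by rw [← hc', of_apply_eq_base]⟩
        · exact ⟨1, ⟨i, g * a⟩ :: t, isReducedList_cons.2 ⟨ha, hl.2⟩,
            by simp only [List.length_cons]; lia, by simp⟩

theorem exists_lengthLE_mul (g : PushoutI φ) :
    ∃ N, ∀ n x, LengthLE φ n x → LengthLE φ (n + N) (g * x) := by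
  induction g using PushoutI.induction_on with
  | of i g => exact ⟨1, fun n x hx => hx.of_mul i g⟩
  | base c => exact ⟨0, fun n x hx => hx.base_mul c⟩
  | mul a b iha ihb =>
    obtain ⟨N, hN⟩ := iha
    obtain ⟨M, hM⟩ := ihb
    refine ⟨M + N, fun n x hx => ?_⟩
    rw [mul_assoc, ← add_assoc]
    exact hN _ _ (hM _ _ hx)

theorem exists_lengthLE (g : PushoutI φ) : ∃ n, LengthLE φ n g := by
  obtain ⟨N, hN⟩ := exists_lengthLE_mul g
  exact ⟨0 + N, by simpa using hN 0 1 ⟨1, [], IsReducedList.nil, le_rfl, by simp⟩⟩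

/-- Powers of a cyclically reduced list are reduced. -/
theorem IsReducedList.exists_pow {l : List (Σ i, G i)} (hl : IsReducedList φ l)
    (hcyc : ∀ x ∈ l.getLast?, ∀ y ∈ l.head?, x.1 ≠ y.1) (k : ℕ) :
    ∃ m, IsReducedList φ m ∧ m.length = k * l.length ∧ listProd φ m = listProd φ l ^ k ∧
      ∀ y ∈ m.head?, y ∈ l.head? := by
  induction k with
  | zero => exact ⟨[], IsReducedList.nil, by simp⟩
  | succ k ih =>
    obtain ⟨m, hm, hlen, hprod, hhead⟩ := ih
    refine ⟨l ++ m, isReducedList_append.2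
      ⟨hl, hm, fun x hx y hy => hcyc x hx y (hhead y hy)⟩, ?_, ?_, ?_⟩
    · rw [List.length_append, hlen]; ring
    · rw [listProd_append, hprod, pow_succ']
    · cases l with
      | nil => simpa using hhead
      | cons => simp

/-- The product of a nonempty cyclically reduced list is not conjugate into a factor. -/
theorem IsReducedList.not_conj_mem_range (hφ : ∀ i, Function.Injective (φ i))
    {l : List (Σ i, G i)} (hl : IsReducedList φ l) (hne : l ≠ [])
    (hcyc : ∀ x ∈ l.getLast?, ∀ y ∈ l.head?, x.1 ≠ y.1) (i : ι) (g : PushoutI φ) :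
    g⁻¹ * listProd φ l * g ∉ (of (φ := φ) i).range := by
  rintro ⟨b, hb⟩
  obtain ⟨n, hn⟩ := exists_lengthLE g⁻¹
  obtain ⟨N, hN⟩ := exists_lengthLE_mul g
  have hbound : ∀ k : ℕ, LengthLE φ (n + 1 + N) (listProd φ l ^ k) := by
    intro k
    have hk : listProd φ l ^ k = g * (of i (b ^ k) * g⁻¹) := by
      rw [map_pow, hb, ← mul_assoc, ← conj_pow]
      congr 1
      group
    rw [hk]
    exact hN _ _ (hn.of_mul i _)
  obtain ⟨m, hm, hlen, hprod, -⟩ := hl.exists_pow hcyc (n + 1 + N + 1)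
  obtain ⟨c, m', hm', hlen', heq⟩ := hbound (n + 1 + N + 1)
  have := hm.length_eq hφ hm' (hprod.trans heq)
  have hpos := List.length_pos_iff.2 hne
  nlinarith

theorem base_range_le_of_range (i : ι) : (base φ).range ≤ (of (φ := φ) i).range := by
  rintro _ ⟨c, rfl⟩
  exact ⟨φ i c, of_apply_eq_base φ i c⟩

theorem conj_mul_of_mem_range {i : ι} {p x : PushoutI φ}
    (h : p⁻¹ * x * p ∈ (of (φ := φ) i).range) (a : G i) :
    (p * of i a)⁻¹ * x * (p * of i a) ∈ (of (φ := φ) i).range := by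
  have ha : of (φ := φ) i a ∈ (of (φ := φ) i).range := ⟨a, rfl⟩
  have := mul_mem (mul_mem (inv_mem ha) h) ha
  simpa [mul_assoc] using this

/-- If `a` and `b` are letters outside the base group, not cancelling against the reduced list
`l`, then `a * l * b * l⁻¹` is not conjugate into a factor. -/
theorem IsReducedList.not_mul_conj_mem_range (hφ : ∀ i, Function.Injective (φ i))
    {l : List (Σ i, G i)} (hl : IsReducedList φ l) {i j : ι} {a : G i} {b : G j}
    (ha : a ∉ (φ i).range) (hb : b ∉ (φ j).range) (hhead : ∀ x ∈ l.head?, i ≠ x.1)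
    (hlast : ∀ x ∈ l.getLast?, x.1 ≠ j) (hij : l = [] → i ≠ j) (r : ι) (g : PushoutI φ) :
    g⁻¹ * (of i a * listProd φ l * of j b * (listProd φ l)⁻¹) * g ∉ (of (φ := φ) r).range := by
  have hinv_head : ∀ y ∈ (PushoutI.invList l).head?, j ≠ y.1 := by
    simp only [PushoutI.invList, List.head?_reverse, List.getLast?_map, Option.mem_def,
      Option.map_eq_some_iff]
    rintro _ ⟨x, hx, rfl⟩
    exact (hlast x hx).symm
  have htail : IsReducedList φ (⟨j, b⟩ :: PushoutI.invList l) :=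
    isReducedList_cons.2 ⟨hb, hinv_head, hl.invList⟩
  have hword : IsReducedList φ (⟨i, a⟩ :: (l ++ ⟨j, b⟩ :: PushoutI.invList l)) := by
    refine isReducedList_cons.2 ⟨ha, ?_, isReducedList_append.2 ⟨hl, htail, ?_⟩⟩
    · cases l with
      | nil => simpa using hij rfl
      | cons x t => simpa using hhead
    · simpa using hlast
  have hcyc : ∀ x ∈ (⟨i, a⟩ :: (l ++ ⟨j, b⟩ :: PushoutI.invList l) : List (Σ i, G i)).getLast?,
      ∀ y ∈ (⟨i, a⟩ :: (l ++ ⟨j, b⟩ :: PushoutI.invList l) : List (Σ i, G i)).head?,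
        x.1 ≠ y.1 := by
    cases l with
    | nil => simpa [PushoutI.invList] using (hij rfl).symm
    | cons x t =>
      have hlast_eq : (⟨i, a⟩ :: (x :: t ++ ⟨j, b⟩ :: PushoutI.invList (x :: t)) :
          List (Σ i, G i)) =
          (⟨i, a⟩ :: (x :: t ++ ⟨j, b⟩ :: PushoutI.invList t)) ++ [⟨x.1, x.2⁻¹⟩] := by
        simp [PushoutI.invList]
      rw [hlast_eq, List.getLast?_concat]
      simpa using (hhead x rfl).symm
  have := hword.not_conj_mem_range hφ (by simp) hcyc r g
  simpa [mul_assoc] using this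

/-- If `K` and `s` are each conjugate into a factor, and every element of `K * s` is conjugate
into a factor, then `K` and `s` are simultaneously conjugate into one factor. Here the list `l`
describes the path between the vertices of the Bass–Serre tree fixed by `K` and `s`. -/
theorem exists_common_conj_of_list (hφ : ∀ i, Function.Injective (φ i))
    (K : Subgroup (PushoutI φ)) (s : PushoutI φ)
    (hell : ∀ k ∈ K, ∃ i, ∃ g : PushoutI φ, g⁻¹ * (k * s) * g ∈ (of (φ := φ) i).range)
    (n : ℕ) (l : List (Σ i, G i)) (hn : l.length = n) (hl : IsReducedList φ l)
    (p : PushoutI φ) (i j : ι) (hK : ∀ k ∈ K, p⁻¹ * k * p ∈ (of (φ := φ) i).range)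
    (hs : (p * listProd φ l)⁻¹ * s * (p * listProd φ l) ∈ (of (φ := φ) j).range) :
    ∃ i, ∃ g : PushoutI φ, (∀ k ∈ K, g⁻¹ * k * g ∈ (of (φ := φ) i).range) ∧
      g⁻¹ * s * g ∈ (of (φ := φ) i).range := by
  have hred : ∀ (l : List (Σ i, G i)) (p : PushoutI φ) (i j : ι), IsReducedList φ l →
      (∀ k ∈ K, p⁻¹ * k * p ∈ (of (φ := φ) i).range) →
      (p * listProd φ l)⁻¹ * s * (p * listProd φ l) ∈ (of (φ := φ) j).range →
      (¬ ∀ k ∈ K, p⁻¹ * k * p ∈ (base φ).range) →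
      (p * listProd φ l)⁻¹ * s * (p * listProd φ l) ∉ (base φ).range →
      (∀ x ∈ l.head?, i ≠ x.1) → (∀ x ∈ l.getLast?, x.1 ≠ j) → (l = [] → i ≠ j) → False := by
    intro l p i j hl hK hs hKC hsC hhead hlast hij
    push Not at hKC
    obtain ⟨k, hk, hkC⟩ := hKC
    obtain ⟨a, ha⟩ := hK k hk
    obtain ⟨b, hb⟩ := hs
    obtain ⟨r, g, hg⟩ := hell k hk
    have haC : a ∉ (φ i).range := by
      rintro ⟨c, rfl⟩
      exact hkC ⟨c, by rw [← ha, of_apply_eq_base]⟩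
    have hbC : b ∉ (φ j).range := by
      rintro ⟨c, rfl⟩
      exact hsC ⟨c, by rw [← hb, of_apply_eq_base]⟩
    refine hl.not_mul_conj_mem_range hφ haC hbC hhead hlast hij r (p⁻¹ * g) ?_
    convert hg using 1
    rw [ha, hb]
    group
  induction n generalizing l p i j with
  | zero =>
    obtain rfl := List.length_eq_zero_iff.1 hn
    simp only [listProd_nil, mul_one] at hs
    by_cases hij : i = j
    · subst hij
      exact ⟨i, p, hK, hs⟩
    by_cases hKC : ∀ k ∈ K, p⁻¹ * k * p ∈ (base φ).range
    · exact ⟨j, p, fun k hk => base_range_le_of_range j (hKC k hk), hs⟩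
    by_cases hsC : p⁻¹ * s * p ∈ (base φ).range
    · exact ⟨i, p, hK, base_range_le_of_range i hsC⟩
    exact (hred [] p i j hl hK (by simpa using hs) hKC (by simpa using hsC) (by simp) (by simp) fun _ => hij).elim
  | succ n ih =>
    by_cases hhead : (∀ k ∈ K, p⁻¹ * k * p ∈ (base φ).range) ∨ ∃ x ∈ l.head?, i = x.1
    · cases l with
      | nil => simp at hn
      | cons x t =>
        have hKx : ∀ k ∈ K, p⁻¹ * k * p ∈ (of (φ := φ) x.1).range := by
          rcases hhead with hKC | ⟨y, hy, rfl⟩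
          · exact fun k hk => base_range_le_of_range x.1 (hKC k hk)
          · obtain rfl : x = y := by simpa using hy
            exact hK
        refine ih t (by simpa using hn) (isReducedList_cons.1 hl).2.2 (p * of x.1 x.2) x.1 j
          (fun k hk => conj_mul_of_mem_range (hKx k hk) x.2) ?_
        rwa [mul_assoc p, ← listProd_cons]
    by_cases hlast : (p * listProd φ l)⁻¹ * s * (p * listProd φ l) ∈ (base φ).range ∨
        ∃ x ∈ l.getLast?, x.1 = j
    · cases l using List.reverseRecOn with
      | nil => simp at hn
      | append_singleton t x =>
        have hsx : (p * listProd φ (t ++ [x]))⁻¹ * s * (p * listProd φ (t ++ [x])) ∈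
            (of (φ := φ) x.1).range := by
          rcases hlast with hsC | ⟨y, hy, rfl⟩
          · exact base_range_le_of_range x.1 hsC
          · obtain rfl : x = y := by simpa using hy
            exact hs
        refine ih t (by simpa using hn) (isReducedList_append.1 hl).1 p i x.1 hK ?_
        have := conj_mul_of_mem_range hsx x.2⁻¹
        have hprod : p * listProd φ (t ++ [x]) * of x.1 x.2⁻¹ = p * listProd φ t := by
          simp [mul_assoc]
        rwa [hprod] at this
    push Not at hhead hlast
    refine (hred l p i j hl hK hs ?_ hlast.1 hhead.2 hlast.2 ?_).elim
    · simpa using hhead.1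
    · rintro rfl
      simp at hn

/-- A finitely generated subgroup of an amalgamated product all of whose elements are conjugate
into a factor is itself conjugate into a factor. -/
theorem exists_conj_le_range_of_fg [Nonempty ι] (hφ : ∀ i, Function.Injective (φ i))
    (H : Subgroup (PushoutI φ)) (hfg : H.FG)
    (hell : ∀ h ∈ H, ∃ i, ∃ g : PushoutI φ, g⁻¹ * h * g ∈ (of (φ := φ) i).range) :
    ∃ i, ∃ g : PushoutI φ, ∀ h ∈ H, g⁻¹ * h * g ∈ (of (φ := φ) i).range := by
  classical
  obtain ⟨S, rfl⟩ := hfg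
  have mem_conj : ∀ (i : ι) (g x : PushoutI φ),
      x ∈ (of (φ := φ) i).range.comap (MulAut.conj g⁻¹).toMonoidHom ↔
        g⁻¹ * x * g ∈ (of (φ := φ) i).range := by
    intro i g x
    simp [Subgroup.mem_comap]
  induction S using Finset.induction_on with
  | empty =>
    refine ⟨Classical.arbitrary ι, 1, fun h hh => ?_⟩
    obtain rfl : h = 1 := by simpa using hh
    simp
  | insert s T _ ih =>
    have hle : Subgroup.closure (T : Set (PushoutI φ)) ≤
        Subgroup.closure (insert s T : Finset (PushoutI φ)) :=
      Subgroup.closure_mono (by simp)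
    have hsmem : s ∈ Subgroup.closure ((insert s T : Finset (PushoutI φ)) : Set (PushoutI φ)) :=
      Subgroup.subset_closure (by simp)
    obtain ⟨i, p, hp⟩ := ih fun h hh => hell h (hle hh)
    obtain ⟨j, q, hq⟩ := hell s hsmem
    obtain ⟨n, c, l, hl, -, hpq⟩ := exists_lengthLE (p⁻¹ * q)
    have hbase : p * base φ c * listProd φ l = q := by
      rw [mul_assoc, ← hpq, mul_inv_cancel_left]
    obtain ⟨r, g, hgT, hgs⟩ := exists_common_conj_of_list hφ
      (Subgroup.closure (T : Set (PushoutI φ))) s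
      (fun k hk => hell _ (mul_mem (hle hk) hsmem)) l.length l rfl hl (p * base φ c) i j
      (fun k hk => by
        rw [← of_apply_eq_base φ i]
        exact conj_mul_of_mem_range (hp k hk) _)
      (by rwa [hbase])
    refine ⟨r, g, fun h hh => (mem_conj r g h).1 ?_⟩
    refine (Subgroup.closure_le _).2 ?_ hh
    intro x hx
    rw [SetLike.mem_coe, mem_conj]
    rcases Finset.mem_insert.1 hx with rfl | hx
    · exact hgs
    · exact hgT x (Subgroup.subset_closure hx)

end Amalgam

end Monoid.PushoutI

/-- In an amalgamated free product A ∗_C B (here A = Gi true, B = Gi false), a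
finitely generated subgroup that is elementwise conjugate into B is conjugate
into A or into B. -/
theorem stmt_8 {C : Type*} [Group C] {Gi : Bool → Type*} [∀ i, Group (Gi i)]
    (φ : ∀ i, C →* Gi i) (hinj : ∀ i, Function.Injective (φ i))
    (H : Subgroup (Monoid.PushoutI φ)) (hfg : H.FG)
    (hconj : ∀ h ∈ H, ∃ g : Monoid.PushoutI φ,
      g⁻¹ * h * g ∈ (Monoid.PushoutI.of (φ := φ) false).range) :
    ∃ g : Monoid.PushoutI φ,
      (∀ h ∈ H, g⁻¹ * h * g ∈ (Monoid.PushoutI.of (φ := φ) true).range) ∨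
      (∀ h ∈ H, g⁻¹ * h * g ∈ (Monoid.PushoutI.of (φ := φ) false).range) := by
  obtain ⟨i, g, hg⟩ := Monoid.PushoutI.exists_conj_le_range_of_fg hinj H hfg
    fun h hh => ⟨false, hconj h hh⟩
  cases i with
  | true => exact ⟨g, Or.inl hg⟩
  | false => exact ⟨g, Or.inr hg⟩
end
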